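/- Let H be the 6×6 Hessian matrix of W_M := X₁X₂X₃X₄ − X₀X₃X₄X₅, i.e. the matrix over ℂ[X₀,…,X₅] with entries H_{ij} = ∂²W_M/∂Xᵢ∂Xⱼ. If A is a 6×6 matrix with complex entries (viewed inside the polynomial ring via the constant embedding) satisfying A·H = H·Aᵀ, then A = λ·I₆ for some scalar λ ∈ ℂ. -/

import Mathlib

open MvPolynomial Matrix

noncomputable section

/-- The polynomial ring `ℂ[X₀,…,X₅]`. -/
abbrev R6 : Type := MvPolynomial (Fin 6) ℂ

/-- The special quartic `W_M = X₁X₂X₃X₄ − X₀X₃X₄X₅`. -/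
def WM : R6 := X 1 * X 2 * X 3 * X 4 - X 0 * X 3 * X 4 * X 5

/-- The Hessian matrix of `W_M`. -/
def HM : Matrix (Fin 6) (Fin 6) R6 :=
  Matrix.of fun i j => pderiv i (pderiv j WM)

/-- The Hessian evaluated at a point `v`. -/
def HMv (v : Fin 6 → ℂ) : Matrix (Fin 6) (Fin 6) ℂ :=
  !![0, 0, 0, -(v 4 * v 5), -(v 3 * v 5), -(v 3 * v 4);
     0, 0, v 3 * v 4, v 2 * v 4, v 2 * v 3, 0;
     0, v 3 * v 4, 0, v 1 * v 4, v 1 * v 3, 0;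
     -(v 4 * v 5), v 2 * v 4, v 1 * v 4, 0, v 1 * v 2 - v 0 * v 5, -(v 0 * v 4);
     -(v 3 * v 5), v 2 * v 3, v 1 * v 3, v 1 * v 2 - v 0 * v 5, 0, -(v 0 * v 3);
     -(v 3 * v 4), 0, 0, -(v 0 * v 4), -(v 0 * v 3), 0]

theorem eval_HM (v : Fin 6 → ℂ) (i j : Fin 6) : eval v (HM i j) = HMv v i j := by
  fin_cases i <;> fin_cases j <;>
    simp [HM, HMv, WM, pderiv_X, Pi.single_apply] <;> ring

theorem key (A : Matrix (Fin 6) (Fin 6) ℂ)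
    (h : A.map (fun a : ℂ => (C a : R6)) * HM =
      HM * (A.map (fun a : ℂ => (C a : R6)))ᵀ) (v : Fin 6 → ℂ) (i j : Fin 6) :
    ∑ k, A i k * HMv v k j = ∑ k, HMv v i k * A j k := by
  have h1 := congrArg (eval v) (congrFun (congrFun h i) j)
  simpa [Matrix.mul_apply, eval_HM] using h1

/-- The only constant `6×6` matrices `A` with `A·H = H·Aᵀ`, where `H` is the
Hessian of `W_M`, are the scalar matrices. -/
theorem stmt5 (A : Matrix (Fin 6) (Fin 6) ℂ)
    (h : A.map (fun a : ℂ => (C a : R6)) * HM =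
      HM * (A.map (fun a : ℂ => (C a : R6)))ᵀ) :
    ∃ lam : ℂ, A = lam • (1 : Matrix (Fin 6) (Fin 6) ℂ) := by
  have k := key A h
  have e01 := k ![0, 0, 1, 0, 1, 0] 0 3
  have e21 := k ![0, 0, 1, 0, 1, 0] 2 3
  have e41 := k ![0, 0, 1, 0, 1, 0] 4 3
  have e51 := k ![0, 0, 1, 0, 1, 0] 5 3
  have e03 := k ![0, 0, 1, 0, 1, 0] 0 1
  have e23 := k ![0, 0, 1, 0, 1, 0] 2 1
  have e43 := k ![0, 0, 1, 0, 1, 0] 4 1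
  have e53 := k ![0, 0, 1, 0, 1, 0] 5 1
  have d1 := k ![0, 0, 1, 0, 1, 0] 1 3
  have e05 := k ![1, 0, 0, 0, 1, 0] 0 3
  have e15 := k ![1, 0, 0, 0, 1, 0] 1 3
  have e25 := k ![1, 0, 0, 0, 1, 0] 2 3
  have e45 := k ![1, 0, 0, 0, 1, 0] 4 3
  have e13 := k ![1, 0, 0, 0, 1, 0] 1 5
  have d5 := k ![1, 0, 0, 0, 1, 0] 5 3
  have e10 := k ![0, 0, 0, 0, 1, 1] 1 3
  have e20 := k ![0, 0, 0, 0, 1, 1] 2 3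
  have e40 := k ![0, 0, 0, 0, 1, 1] 4 3
  have e50 := k ![0, 0, 0, 0, 1, 1] 5 3
  have d0 := k ![0, 0, 0, 0, 1, 1] 0 3
  have e02 := k ![0, 1, 0, 0, 1, 0] 0 3
  have e12 := k ![0, 1, 0, 0, 1, 0] 1 3
  have e42 := k ![0, 1, 0, 0, 1, 0] 4 3
  have e52 := k ![0, 1, 0, 0, 1, 0] 5 3
  have d2 := k ![0, 1, 0, 0, 1, 0] 2 3
  have e31 := k ![0, 0, 1, 1, 0, 0] 3 4
  have e04 := k ![0, 0, 1, 1, 0, 0] 0 1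
  have e24 := k ![0, 0, 1, 1, 0, 0] 2 1
  have e34 := k ![0, 0, 1, 1, 0, 0] 3 1
  have e54 := k ![0, 0, 1, 1, 0, 0] 5 1
  have e30 := k ![0, 0, 0, 1, 0, 1] 3 4
  have e14 := k ![0, 0, 0, 1, 0, 1] 1 0
  have e32 := k ![0, 1, 0, 1, 0, 0] 3 4
  have e35 := k ![1, 0, 0, 1, 0, 0] 3 4
  have d3 := k ![0, 1, 1, 0, 0, 0] 3 4
  simp [HMv, Fin.sum_univ_six] at e01 e21 e41 e51 e03 e23 e43 e53 d1 e05 e15 e25 e45 e13 d5 e10 e20 e40 e50 d0 e02 e12 e42 e52 d2 e31 e04 e24 e34 e54 e30 e14 e32 e35 d3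
  refine ⟨A 3 3, ?_⟩
  ext i j
  fin_cases i <;> fin_cases j <;> simp [*]

end
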